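/- There is an absolute constant C such that every sequence f = (f_k) ∈ L¹(ℓ₁) of functions on 𝕋 admits a simultaneous good lifting modulo analytic functions: there exists a sequence g = (g_k) with every g_k ∈ H¹ such that ‖f − g‖_{L¹(ℓ₁)} ≤ C·inf{‖f − h‖_{L¹(ℓ₁)} : all h_k ∈ H¹} and ‖f − g‖_{L¹(ℓ₂)} ≤ C·inf{‖f − h‖_{L¹(ℓ₂)} : all h_k ∈ H¹}. -/

import Mathlib

open MeasureTheory Real ENNReal NNReal

noncomputable section

instance : Fact (0 < 2 * Real.pi) := ⟨by positivity⟩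

/-- The circle group `𝕋`, realized as `ℝ / 2πℤ`. -/
abbrev 𝕋 : Type := AddCircle (2 * Real.pi)

/-- The normalized Haar measure on `𝕋`. -/
abbrev μ𝕋 : Measure 𝕋 := AddCircle.haarAddCircle

/-- The mixed norm `‖f‖_{L^p(ℓ_q)} = (∫ (∑_k |f_k|^q)^{p/q} dm)^{1/p}` of a sequence
`f = (f_k)` of functions on `𝕋`, valued in `ℝ≥0∞`. -/
def eLpLqNorm (p q : ℝ) (f : ℕ → 𝕋 → ℂ) : ℝ≥0∞ :=
  (∫⁻ t, ((∑' k, (‖f k t‖₊ : ℝ≥0∞) ^ q) ^ (1 / q)) ^ p ∂μ𝕋) ^ (1 / p)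

/-- `f = (f_k)` belongs to `L^p(ℓ_q)`. -/
def MemLpLq (p q : ℝ) (f : ℕ → 𝕋 → ℂ) : Prop :=
  (∀ k, AEStronglyMeasurable (f k) μ𝕋) ∧ eLpLqNorm p q f < ⊤

/-- `f = (f_k)` belongs to `H^p(ℓ_q)`: it belongs to `L^p(ℓ_q)` and every Fourier
coefficient `f̂_k(n)` with `n < 0` vanishes. -/
def MemHpLq (p q : ℝ) (f : ℕ → 𝕋 → ℂ) : Prop :=
  MemLpLq p q f ∧ ∀ k, ∀ n : ℤ, n < 0 → fourierCoeff (f k) n = 0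

/-- The K-functional `K_t(f; X₀, X₁)` for a couple of spaces of sequences of functions given
by membership predicates `X₀, X₁` and (quasi-)norms `N₀, N₁`:
`inf {N₀(g₀) + t N₁(g₁) : f = g₀ + g₁, g₀ ∈ X₀, g₁ ∈ X₁}`. -/
def Kfunctional (t : ℝ≥0∞) (X₀ X₁ : (ℕ → 𝕋 → ℂ) → Prop)
    (N₀ N₁ : (ℕ → 𝕋 → ℂ) → ℝ≥0∞) (f : ℕ → 𝕋 → ℂ) : ℝ≥0∞ :=
  ⨅ (g₀ : ℕ → 𝕋 → ℂ) (g₁ : ℕ → 𝕋 → ℂ) (_ : X₀ g₀) (_ : X₁ g₁) (_ : f = g₀ + g₁),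
    N₀ g₀ + t * N₁ g₁

/-- A function on `𝕋` belongs to `H¹`: it is integrable and its Fourier coefficients vanish
on the negative integers. -/
def MemH1 (g : 𝕋 → ℂ) : Prop :=
  Integrable g μ𝕋 ∧ ∀ n : ℤ, n < 0 → fourierCoeff g n = 0

/-- The quotient norm `‖f‖_{L¹/H¹(ℓ_q)} = inf {‖f − h‖_{L¹(ℓ_q)} : every h_k ∈ H¹}`. -/
def quotNormLq (q : ℝ) (f : ℕ → 𝕋 → ℂ) : ℝ≥0∞ :=
  ⨅ (h : ℕ → 𝕋 → ℂ) (_ : ∀ k, MemH1 (h k)), eLpLqNorm 1 q (f - h)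

open Filter Topology

theorem MemH1.add {f g : 𝕋 → ℂ} (hf : MemH1 f) (hg : MemH1 g) :
    MemH1 (fun t => f t + g t) := by
  refine ⟨hf.1.add hg.1, fun n hn => ?_⟩
  have := congrFun (fourierCoeff.add hf.1 hg.1) n
  simp only [Pi.add_apply, hf.2 n hn, hg.2 n hn, add_zero] at this
  exact this

theorem MemH1.const_mul {f : 𝕋 → ℂ} (hf : MemH1 f) (c : ℂ) : MemH1 (fun t => c * f t) :=
  ⟨hf.1.const_mul c, fun n hn => by rw [fourierCoeff.const_mul, hf.2 n hn, mul_zero]⟩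

theorem MemH1.sub {f g : 𝕋 → ℂ} (hf : MemH1 f) (hg : MemH1 g) :
    MemH1 (fun t => f t - g t) := by
  simpa [sub_eq_add_neg] using hf.add (hg.const_mul (-1))

theorem MemH1.of_tendsto {F : ℕ → 𝕋 → ℂ} {f : 𝕋 → ℂ} {G : 𝕋 → ℝ} (hF : ∀ n, MemH1 (F n))
    (hG : Integrable G μ𝕋) (hFG : ∀ n, ∀ᵐ t ∂μ𝕋, ‖F n t‖ ≤ G t)
    (hlim : ∀ᵐ t ∂μ𝕋, Tendsto (fun n => F n t) atTop (𝓝 (f t))) : MemH1 f := by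
  have hmeas : AEStronglyMeasurable f μ𝕋 :=
    aestronglyMeasurable_of_tendsto_ae atTop (fun n => (hF n).1.1) hlim
  refine ⟨hG.mono' hmeas ?_, fun m hm => ?_⟩
  · filter_upwards [hlim, ae_all_iff.2 hFG] with t ht h
    exact le_of_tendsto ht.norm (Eventually.of_forall h)
  · have h := tendsto_integral_of_dominated_convergence (μ := μ𝕋)
      (F := fun n t => fourier (-m) t • F n t) (f := fun t => fourier (-m) t • f t) G
      (fun n => ((hF n).1.fourier_smul _).1) hG
      (fun n => by
        filter_upwards [hFG n] with t ht
        rw [norm_smul, fourier_apply, Circle.norm_coe, one_mul]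
        exact ht)
      (by
        filter_upwards [hlim] with t ht
        exact ht.const_smul _)
    have h0 : (fun n => ∫ t, fourier (-m) t • F n t ∂μ𝕋) = fun _ => 0 := by
      funext n
      exact (hF n).2 m hm
    rw [h0] at h
    exact (tendsto_nhds_unique h tendsto_const_nhds)

/-- A function belongs to `H¹` as soon as it is approximated by `H¹` functions in `L¹`. -/
theorem MemH1.of_forall_exists {f : 𝕋 → ℂ} (hf : Integrable f μ𝕋)
    (h : ∀ ε : ℝ≥0∞, 0 < ε → ∃ g, MemH1 g ∧ ∫⁻ t, ‖f t - g t‖ₑ ∂μ𝕋 ≤ ε) : MemH1 f := by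
  refine ⟨hf, fun n hn => ?_⟩
  rw [← enorm_eq_zero]
  refine le_antisymm (_root_.le_of_forall_pos_le_add fun ε hε => ?_) bot_le
  obtain ⟨g, hg, hfg⟩ := h ε hε
  have hsub : fourierCoeff f n = ∫ t, fourier (-n) t • (f t - g t) ∂μ𝕋 := by
    have h1 := integral_sub (hf.fourier_smul (-n)) (hg.1.fourier_smul (-n))
    have h2 : ∫ t, fourier (-n) t • g t ∂μ𝕋 = 0 := hg.2 n hn
    simp only [smul_sub]
    rw [h1, h2, sub_zero]
    rfl
  rw [hsub, zero_add]
  refine (enorm_integral_le_lintegral_enorm _).trans ((lintegral_mono fun t => ?_).trans hfg)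
  rw [enorm_smul, fourier_apply, ← ofReal_norm, Circle.norm_coe, ENNReal.ofReal_one, one_mul]

/-- Essentially bounded functions that multiply `H¹` into itself. -/
structure IsH1Multiplier (φ : 𝕋 → ℂ) : Prop where
  aestronglyMeasurable : AEStronglyMeasurable φ μ𝕋
  bounded : ∃ C : ℝ, ∀ᵐ t ∂μ𝕋, ‖φ t‖ ≤ C
  mul_mem : ∀ A, MemH1 A → MemH1 (fun t => A t * φ t)

namespace IsH1Multiplier

theorem const (c : ℂ) : IsH1Multiplier (fun _ => c) where
  aestronglyMeasurable := aestronglyMeasurable_const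
  bounded := ⟨‖c‖, Eventually.of_forall fun _ => le_rfl⟩
  mul_mem A hA := by simpa [mul_comm] using hA.const_mul c

theorem add {φ ψ : 𝕋 → ℂ} (hφ : IsH1Multiplier φ) (hψ : IsH1Multiplier ψ) :
    IsH1Multiplier (fun t => φ t + ψ t) where
  aestronglyMeasurable := hφ.1.add hψ.1
  bounded := by
    obtain ⟨C, hC⟩ := hφ.2
    obtain ⟨D, hD⟩ := hψ.2
    refine ⟨C + D, ?_⟩
    filter_upwards [hC, hD] with t h1 h2
    exact (norm_add_le _ _).trans (add_le_add h1 h2)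
  mul_mem A hA := by
    simpa [mul_add] using (hφ.3 A hA).add (hψ.3 A hA)

theorem mul {φ ψ : 𝕋 → ℂ} (hφ : IsH1Multiplier φ) (hψ : IsH1Multiplier ψ) :
    IsH1Multiplier (fun t => φ t * ψ t) where
  aestronglyMeasurable := hφ.1.mul hψ.1
  bounded := by
    obtain ⟨C, hC⟩ := hφ.2
    obtain ⟨D, hD⟩ := hψ.2
    refine ⟨C * D, ?_⟩
    filter_upwards [hC, hD] with t h1 h2
    rw [norm_mul]
    exact mul_le_mul h1 h2 (norm_nonneg _) ((norm_nonneg _).trans h1)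
  mul_mem A hA := by
    simpa [mul_assoc] using hψ.3 _ (hφ.3 A hA)

theorem const_mul {φ : 𝕋 → ℂ} (hφ : IsH1Multiplier φ) (c : ℂ) :
    IsH1Multiplier (fun t => c * φ t) :=
  (const c).mul hφ

theorem sub {φ ψ : 𝕋 → ℂ} (hφ : IsH1Multiplier φ) (hψ : IsH1Multiplier ψ) :
    IsH1Multiplier (fun t => φ t - ψ t) := by
  simpa [sub_eq_add_neg] using hφ.add (hψ.const_mul (-1))

theorem pow {φ : 𝕋 → ℂ} (hφ : IsH1Multiplier φ) (n : ℕ) :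
    IsH1Multiplier (fun t => φ t ^ n) := by
  induction n with
  | zero => simpa using const 1
  | succ n ih => simpa only [pow_succ] using ih.mul hφ

theorem sum {ι : Type*} {φ : ι → 𝕋 → ℂ} (hφ : ∀ i, IsH1Multiplier (φ i)) (s : Finset ι) :
    IsH1Multiplier (fun t => ∑ i ∈ s, φ i t) := by
  classical
  induction s using Finset.induction_on with
  | empty => simpa using const 0
  | insert i s hi ih => simpa only [Finset.sum_insert hi] using (hφ i).add ih

theorem fourier_of_nonneg {n : ℤ} (hn : 0 ≤ n) : IsH1Multiplier (fun t => fourier n t) where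
  aestronglyMeasurable := (map_continuous (fourier n)).aestronglyMeasurable
  bounded := ⟨1, Eventually.of_forall fun t => by rw [fourier_apply, Circle.norm_coe]⟩
  mul_mem A hA := by
    refine ⟨by simpa [mul_comm] using hA.1.fourier_smul n, fun m hm => ?_⟩
    rw [← hA.2 (m - n) (by lia)]
    unfold fourierCoeff
    congr 1
    funext t
    rw [show -(m - n) = -m + n by ring, fourier_add]
    simp only [smul_eq_mul]
    ring

theorem of_tendsto {φ : ℕ → 𝕋 → ℂ} {ψ : 𝕋 → ℂ} {C : ℝ} (hφ : ∀ n, IsH1Multiplier (φ n))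
    (hC : ∀ n, ∀ᵐ t ∂μ𝕋, ‖φ n t‖ ≤ C)
    (hlim : ∀ᵐ t ∂μ𝕋, Tendsto (fun n => φ n t) atTop (𝓝 (ψ t))) : IsH1Multiplier ψ where
  aestronglyMeasurable := aestronglyMeasurable_of_tendsto_ae atTop (fun n => (hφ n).1) hlim
  bounded := by
    refine ⟨C, ?_⟩
    filter_upwards [hlim, ae_all_iff.2 hC] with t ht h
    exact le_of_tendsto ht.norm (Eventually.of_forall h)
  mul_mem A hA := by
    refine MemH1.of_tendsto (F := fun n t => A t * φ n t) (G := fun t => ‖A t‖ * C)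
      (fun n => (hφ n).3 A hA) (hA.1.norm.mul_const C) (fun n => ?_) ?_
    · filter_upwards [hC n] with t ht
      rw [norm_mul]
      gcongr
    · filter_upwards [hlim] with t ht
      exact ht.const_mul _

theorem comp_of_differentiableOn_ball {φ : 𝕋 → ℂ} (hφ : IsH1Multiplier φ) {c : ℂ} {ρ R : ℝ}
    (hρ : ∀ᵐ t ∂μ𝕋, ‖φ t - c‖ ≤ ρ) (hρR : ρ < R) {Ψ : ℂ → ℂ}
    (hΨ : DifferentiableOn ℂ Ψ (Metric.ball c R)) : IsH1Multiplier (fun t => Ψ (φ t)) := by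
  obtain ⟨t₀, ht₀⟩ := hρ.exists
  have hρ0 : 0 ≤ ρ := (norm_nonneg _).trans ht₀
  set a : ℕ → ℂ := fun n => (n.factorial : ℂ)⁻¹ * iteratedDeriv n Ψ c with ha
  have hsum : ∀ z, ‖z - c‖ < R → HasSum (fun n => a n * (z - c) ^ n) (Ψ z) := by
    intro z hz
    have := Complex.hasSum_taylorSeries_on_ball hΨ (z := z) (by simpa [dist_eq_norm] using hz)
    refine this.congr_fun fun n => ?_
    simp only [ha, smul_eq_mul]
    ring
  have hsummable : Summable (fun n => ‖a n‖ * ρ ^ n) := by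
    have h := (hsum (c + ρ) (by simpa [abs_of_nonneg hρ0] using hρR)).summable.norm
    simpa [abs_of_nonneg hρ0] using h
  refine of_tendsto (φ := fun N t => ∑ n ∈ Finset.range N, a n * (φ t - c) ^ n)
    (C := ∑' n, ‖a n‖ * ρ ^ n)
    (fun N => sum (fun n => ((hφ.sub (const c)).pow n).const_mul (a n)) _) (fun N => ?_) ?_
  · filter_upwards [hρ] with t ht
    calc ‖∑ n ∈ Finset.range N, a n * (φ t - c) ^ n‖
        ≤ ∑ n ∈ Finset.range N, ‖a n * (φ t - c) ^ n‖ := norm_sum_le _ _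
      _ ≤ ∑ n ∈ Finset.range N, ‖a n‖ * ρ ^ n := by
          refine Finset.sum_le_sum fun n _ => ?_
          rw [norm_mul, norm_pow]
          gcongr
      _ ≤ ∑' n, ‖a n‖ * ρ ^ n := hsummable.sum_le_tsum _ fun n _ => by positivity
  · filter_upwards [hρ] with t ht
    exact (hsum (φ t) (ht.trans_lt hρR)).tendsto_sum_nat

theorem comp_of_differentiableOn_re_pos {φ : 𝕋 → ℂ} (hφ : IsH1Multiplier φ) {ε : ℝ} (hε : 0 < ε)
    (hre : ∀ᵐ t ∂μ𝕋, ε ≤ (φ t).re) {Ψ : ℂ → ℂ} (hΨ : DifferentiableOn ℂ Ψ {z | 0 < z.re}) :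
    IsH1Multiplier (fun t => Ψ (φ t)) := by
  obtain ⟨C, hC⟩ := hφ.2
  obtain ⟨t₀, ht₀, ht₁⟩ := (hC.and hre).exists
  have hεC : ε ≤ C := ht₁.trans ((Complex.re_le_norm _).trans ht₀)
  have hC0 : 0 < C := hε.trans_le hεC
  set R : ℝ := C ^ 2 / ε with hR
  have hRε : R * ε = C ^ 2 := by rw [hR]; field_simp
  have hR0 : 0 < R := by positivity
  refine hφ.comp_of_differentiableOn_ball (c := (R : ℂ)) (ρ := √(R ^ 2 - C ^ 2)) (R := R) ?_ ?_
    (hΨ.mono fun z hz => ?_)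
  · filter_upwards [hC, hre] with t h1 h2
    refine Real.le_sqrt_of_sq_le ?_
    have h3 : ‖φ t‖ ^ 2 ≤ C ^ 2 := by gcongr
    rw [Complex.sq_norm, Complex.normSq_apply] at h3 ⊢
    simp only [Complex.sub_re, Complex.sub_im, Complex.ofReal_re, Complex.ofReal_im]
    nlinarith [mul_le_mul_of_nonneg_left h2 hR0.le]
  · rw [Real.sqrt_lt' hR0]
    nlinarith
  · rw [Metric.mem_ball, dist_eq_norm] at hz
    have := (Complex.abs_re_le_norm (z - R)).trans_lt hz
    rw [abs_lt] at this
    simp only [Complex.sub_re, Complex.ofReal_re] at this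
    show 0 < z.re
    linarith

end IsH1Multiplier

theorem Complex.cpow_inv_two_sq (z : ℂ) : (z ^ (2⁻¹ : ℂ)) ^ 2 = z := by
  exact_mod_cast Complex.cpow_nat_inv_pow z two_ne_zero

theorem Complex.norm_cpow_inv_two_sq (z : ℂ) : ‖z ^ (2⁻¹ : ℂ)‖ ^ 2 = ‖z‖ := by
  rw [← norm_pow, Complex.cpow_inv_two_sq]

theorem Complex.sqrt_re_le_re_cpow_inv_two (z : ℂ) : √z.re ≤ (z ^ (2⁻¹ : ℂ)).re := by
  rw [Complex.cpow_inv_two_re]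
  exact Real.sqrt_le_sqrt (by linarith [Complex.re_le_norm z])

theorem Complex.abs_im_cpow_inv_two_le_re {z : ℂ} (hz : 0 ≤ z.re) :
    |(z ^ (2⁻¹ : ℂ)).im| ≤ (z ^ (2⁻¹ : ℂ)).re := by
  have h0 := (Real.sqrt_nonneg _).trans (Complex.sqrt_re_le_re_cpow_inv_two z)
  refine abs_le_of_sq_le_sq ?_ h0
  have h := congrArg Complex.re (Complex.cpow_inv_two_sq z)
  rw [sq, Complex.mul_re] at h
  nlinarith

/-- The quotient `√z / (√z + √w)`. -/
def sqrtQuotient (z w : ℂ) : ℂ := z ^ (2⁻¹ : ℂ) * (z ^ (2⁻¹ : ℂ) + w ^ (2⁻¹ : ℂ))⁻¹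

theorem norm_add_norm_le_norm_cpow_add_cpow_sq {z w : ℂ} (hz : 0 ≤ z.re) (hw : 0 ≤ w.re) :
    ‖z‖ + ‖w‖ ≤ ‖z ^ (2⁻¹ : ℂ) + w ^ (2⁻¹ : ℂ)‖ ^ 2 := by
  have h1 := Complex.abs_im_cpow_inv_two_le_re hz
  have h2 := Complex.abs_im_cpow_inv_two_le_re hw
  rw [← Complex.norm_cpow_inv_two_sq z, ← Complex.norm_cpow_inv_two_sq w]
  simp only [Complex.sq_norm, Complex.normSq_apply, Complex.add_re, Complex.add_im]
  have h3 : |(z ^ (2⁻¹ : ℂ)).im * (w ^ (2⁻¹ : ℂ)).im| ≤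
      (z ^ (2⁻¹ : ℂ)).re * (w ^ (2⁻¹ : ℂ)).re := by
    rw [abs_mul]
    exact mul_le_mul h1 h2 (abs_nonneg _) ((abs_nonneg _).trans h1)
  rw [abs_le] at h3
  nlinarith

section sqrtQuotient

variable {z w : ℂ}

theorem cpow_add_cpow_ne_zero (hz : 0 < z.re) (hw : 0 ≤ w.re) :
    z ^ (2⁻¹ : ℂ) + w ^ (2⁻¹ : ℂ) ≠ 0 := by
  intro h
  have h1 := norm_add_norm_le_norm_cpow_add_cpow_sq hz.le hw
  rw [h] at h1
  have := hz.trans_le (Complex.re_le_norm z)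
  norm_num at h1
  linarith [norm_nonneg w]

theorem norm_sqrtQuotient_sq_le (hz : 0 < z.re) (hw : 0 ≤ w.re) :
    ‖sqrtQuotient z w‖ ^ 2 ≤ ‖z‖ / (‖z‖ + ‖w‖) := by
  have h0 := hz.trans_le (Complex.re_le_norm z)
  rw [sqrtQuotient, norm_mul, norm_inv, mul_pow, inv_pow, Complex.norm_cpow_inv_two_sq,
    ← div_eq_mul_inv]
  have := norm_add_norm_le_norm_cpow_add_cpow_sq hz.le hw
  gcongr

theorem norm_one_sub_sqrtQuotient_sq_le (hz : 0 < z.re) (hw : 0 ≤ w.re) :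
    ‖1 - sqrtQuotient z w‖ ^ 2 ≤ ‖w‖ / (‖z‖ + ‖w‖) := by
  have h0 := hz.trans_le (Complex.re_le_norm z)
  have hne := cpow_add_cpow_ne_zero hz hw
  have : 1 - sqrtQuotient z w = w ^ (2⁻¹ : ℂ) * (z ^ (2⁻¹ : ℂ) + w ^ (2⁻¹ : ℂ))⁻¹ := by
    rw [sqrtQuotient]
    linear_combination -(mul_inv_cancel₀ hne)
  rw [this, norm_mul, norm_inv, mul_pow, inv_pow, Complex.norm_cpow_inv_two_sq,
    ← div_eq_mul_inv]
  have := norm_add_norm_le_norm_cpow_add_cpow_sq hz.le hw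
  gcongr

theorem norm_sqrtQuotient_le_one (hz : 0 < z.re) (hw : 0 ≤ w.re) : ‖sqrtQuotient z w‖ ≤ 1 := by
  have h0 := hz.trans_le (Complex.re_le_norm z)
  refine (sq_le_one_iff₀ (norm_nonneg _)).1 ((norm_sqrtQuotient_sq_le hz hw).trans ?_)
  exact div_le_one_of_le₀ (by linarith [norm_nonneg w]) (by positivity)

end sqrtQuotient

theorem IsH1Multiplier.sqrtQuotient {φ ψ : 𝕋 → ℂ} (hφ : IsH1Multiplier φ)
    (hψ : IsH1Multiplier ψ) {ε : ℝ} (hε : 0 < ε) (hφε : ∀ᵐ t ∂μ𝕋, ε ≤ (φ t).re)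
    (hψε : ∀ᵐ t ∂μ𝕋, ε ≤ (ψ t).re) : IsH1Multiplier (fun t => sqrtQuotient (φ t) (ψ t)) := by
  have hd : DifferentiableOn ℂ (fun z : ℂ => z ^ (2⁻¹ : ℂ)) {z | 0 < z.re} := fun z hz =>
    (differentiableAt_id.cpow_const (Or.inl hz)).differentiableWithinAt
  have h1 := hφ.comp_of_differentiableOn_re_pos hε hφε hd
  have h2 := hψ.comp_of_differentiableOn_re_pos hε hψε hd
  refine h1.mul ((h1.add h2).comp_of_differentiableOn_re_pos (Ψ := fun z => z⁻¹)
    (Real.sqrt_pos.2 hε) ?_ fun z hz => ?_)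
  · filter_upwards [hφε, hψε] with t ht1 ht2
    rw [Complex.add_re]
    have h3 := (Real.sqrt_le_sqrt ht1).trans (Complex.sqrt_re_le_re_cpow_inv_two (φ t))
    have h4 := (Real.sqrt_nonneg _).trans (Complex.sqrt_re_le_re_cpow_inv_two (ψ t))
    linarith
  · refine (differentiableAt_inv ?_).differentiableWithinAt
    rintro rfl
    simp at hz

/-- Functions that are almost everywhere limits of bounded analytic functions with real parts
uniformly bounded below by a positive constant. -/
def IsHerglotz (O : 𝕋 → ℂ) : Prop :=
  ∃ ε : ℝ, 0 < ε ∧ ∃ P : ℕ → 𝕋 → ℂ, (∀ n, IsH1Multiplier (P n)) ∧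
    (∀ n, ∀ᵐ t ∂μ𝕋, ε ≤ (P n t).re) ∧ ∀ᵐ t ∂μ𝕋, Tendsto (fun n => P n t) atTop (𝓝 (O t))

namespace IsHerglotz

variable {O h : 𝕋 → ℂ}

theorem aestronglyMeasurable (hO : IsHerglotz O) : AEStronglyMeasurable O μ𝕋 := by
  obtain ⟨ε, -, P, hP, -, hlim⟩ := hO
  exact aestronglyMeasurable_of_tendsto_ae atTop (fun n => (hP n).1) hlim

theorem exists_re_ge (hO : IsHerglotz O) : ∃ ε > 0, ∀ᵐ t ∂μ𝕋, ε ≤ (O t).re := by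
  obtain ⟨ε, hε, P, -, hre, hlim⟩ := hO
  refine ⟨ε, hε, ?_⟩
  filter_upwards [hlim, ae_all_iff.2 hre] with t ht h
  exact ge_of_tendsto ((Complex.continuous_re.tendsto _).comp ht) (Eventually.of_forall h)

theorem re_pos (hO : IsHerglotz O) : ∀ᵐ t ∂μ𝕋, 0 < (O t).re := by
  obtain ⟨ε, hε, h⟩ := hO.exists_re_ge
  filter_upwards [h] with t ht using hε.trans_le ht

theorem const_mul (hO : IsHerglotz O) {r : ℝ} (hr : 0 < r) : IsHerglotz (fun t => r * O t) := by
  obtain ⟨ε, hε, P, hP, hre, hlim⟩ := hO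
  refine ⟨r * ε, by positivity, fun n t => r * P n t, fun n => (hP n).const_mul r,
    fun n => ?_, ?_⟩
  · filter_upwards [hre n] with t ht
    rw [Complex.re_ofReal_mul]
    gcongr
  · filter_upwards [hlim] with t ht using ht.const_mul _

theorem isH1Multiplier_sqrtQuotient (hO : IsHerglotz O) (hh : IsHerglotz h) :
    IsH1Multiplier (fun t => sqrtQuotient (O t) (h t)) := by
  have hO' := hO.re_pos
  have hh' := hh.re_pos
  obtain ⟨ε, hε, P, hP, hPre, hPlim⟩ := hO
  obtain ⟨δ, hδ, R, hR, hRre, hRlim⟩ := hh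
  refine IsH1Multiplier.of_tendsto (φ := fun n t => sqrtQuotient (P n t) (R n t)) (C := 1)
    (fun n => (hP n).sqrtQuotient (hR n) (lt_min hε hδ) ?_ ?_) (fun n => ?_) ?_
  · filter_upwards [hPre n] with t ht using (min_le_left _ _).trans ht
  · filter_upwards [hRre n] with t ht using (min_le_right _ _).trans ht
  · filter_upwards [hPre n, hRre n] with t h1 h2
    exact norm_sqrtQuotient_le_one (hε.trans_le h1) (hδ.le.trans h2)
  · filter_upwards [hPlim, hRlim, hO', hh'] with t h1 h2 h3 h4
    have h5 := h1.cpow (tendsto_const_nhds (x := (2⁻¹ : ℂ))) (Or.inl h3)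
    have h6 := h2.cpow (tendsto_const_nhds (x := (2⁻¹ : ℂ))) (Or.inl h4)
    exact h5.mul ((h5.add h6).inv₀ (cpow_add_cpow_ne_zero h3 h4.le))

end IsHerglotz

/-- The analytic trigonometric polynomials. -/
def analyticPoly : Submodule ℂ C(𝕋, ℂ) :=
  Submodule.span ℂ (Set.range fun n : ℕ => fourier (n : ℤ))

theorem fourier_mem_analyticPoly {n : ℤ} (hn : 0 ≤ n) : fourier n ∈ analyticPoly := by
  lift n to ℕ using hn
  exact Submodule.subset_span ⟨n, rfl⟩

theorem isH1Multiplier_of_mem_analyticPoly {p : C(𝕋, ℂ)} (hp : p ∈ analyticPoly) :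
    IsH1Multiplier p := by
  refine Submodule.span_induction (p := fun (q : C(𝕋, ℂ)) _ => IsH1Multiplier q) ?_ ?_ ?_ ?_ hp
  · rintro _ ⟨n, rfl⟩
    exact IsH1Multiplier.fourier_of_nonneg (Int.natCast_nonneg n)
  · exact IsH1Multiplier.const 0
  · exact fun _ _ _ _ h₁ h₂ => h₁.add h₂
  · exact fun c _ _ h => h.const_mul c

theorem integrable_of_continuousMap (f : C(𝕋, ℂ)) : Integrable f μ𝕋 :=
  (map_continuous f).integrable_of_hasCompactSupport (HasCompactSupport.of_compactSpace _)

theorem integral_fourier (n : ℤ) : ∫ t, fourier n t ∂μ𝕋 = if n = 0 then 1 else 0 := by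
  have h := congrFun (fourierCoeff_fourier (T := 2 * Real.pi) n) 0
  simp only [fourierCoeff, neg_zero, fourier_zero, one_smul] at h
  rw [h, Pi.single_apply]
  simp [eq_comm]

theorem integral_continuousMap_add (f g : C(𝕋, ℂ)) :
    ∫ t, (f + g) t ∂μ𝕋 = (∫ t, f t ∂μ𝕋) + ∫ t, g t ∂μ𝕋 :=
  integral_add (integrable_of_continuousMap f) (integrable_of_continuousMap g)

theorem integral_continuousMap_smul (c : ℂ) (f : C(𝕋, ℂ)) :
    ∫ t, (c • f) t ∂μ𝕋 = c * ∫ t, f t ∂μ𝕋 :=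
  integral_const_mul c f

theorem integral_mul_of_mem_analyticPoly {p q : C(𝕋, ℂ)} (hp : p ∈ analyticPoly)
    (hq : q ∈ analyticPoly) :
    ∫ t, (p * q) t ∂μ𝕋 = (∫ t, p t ∂μ𝕋) * ∫ t, q t ∂μ𝕋 := by
  refine Submodule.span_induction
    (p := fun p _ => ∫ t, (p * q) t ∂μ𝕋 = (∫ t, p t ∂μ𝕋) * ∫ t, q t ∂μ𝕋) ?_ ?_ ?_ ?_ hp
  · rintro _ ⟨n, rfl⟩
    refine Submodule.span_induction (p := fun q _ => ∫ t, (fourier (n : ℤ) * q) t ∂μ𝕋 =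
      (∫ t, fourier (n : ℤ) t ∂μ𝕋) * ∫ t, q t ∂μ𝕋) ?_ ?_ ?_ ?_ hq
    · rintro _ ⟨m, rfl⟩
      simp only [ContinuousMap.mul_apply, ← fourier_add, integral_fourier]
      split_ifs <;> lia
    · simp
    · intro q₁ q₂ _ _ h₁ h₂
      rw [mul_add, integral_continuousMap_add, integral_continuousMap_add, h₁, h₂, mul_add]
    · intro c q _ h
      rw [mul_smul_comm, integral_continuousMap_smul, integral_continuousMap_smul, h,
        mul_left_comm]
  · simp
  · intro p₁ p₂ _ _ h₁ h₂
    rw [add_mul, integral_continuousMap_add, integral_continuousMap_add, h₁, h₂, add_mul]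
  · intro c p _ h
    rw [smul_mul_assoc, integral_continuousMap_smul, integral_continuousMap_smul, h, mul_assoc]

theorem exists_mem_analyticPoly_re_eq {τ : C(𝕋, ℂ)}
    (hτ : τ ∈ Submodule.span ℂ (Set.range (fourier (T := 2 * Real.pi)))) :
    ∃ p ∈ analyticPoly, (∫ t, p t ∂μ𝕋).im = 0 ∧ ∀ t, (p t).re = (τ t).re := by
  have key : ∀ c : ℂ, ∃ p ∈ analyticPoly, ∀ t, (p t).re = (c * τ t).re := by
    refine Submodule.span_induction
      (p := fun τ _ => ∀ c : ℂ, ∃ p ∈ analyticPoly, ∀ t, (p t).re = (c * τ t).re) ?_ ?_ ?_ ?_ hτ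
    · rintro _ ⟨n, rfl⟩ c
      rcases le_total 0 n with hn | hn
      · exact ⟨c • fourier n, Submodule.smul_mem _ _ (fourier_mem_analyticPoly hn),
          fun t => by simp⟩
      · refine ⟨(starRingEnd ℂ c) • fourier (-n),
          Submodule.smul_mem _ _ (fourier_mem_analyticPoly (by lia)), fun t => ?_⟩
        rw [ContinuousMap.smul_apply, fourier_neg, smul_eq_mul, ← map_mul, Complex.conj_re]
    · exact fun c => ⟨0, Submodule.zero_mem _, fun t => by simp⟩
    · intro τ₁ τ₂ _ _ h₁ h₂ c
      obtain ⟨p₁, hp₁, h₁⟩ := h₁ c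
      obtain ⟨p₂, hp₂, h₂⟩ := h₂ c
      exact ⟨p₁ + p₂, Submodule.add_mem _ hp₁ hp₂, fun t => by
        rw [ContinuousMap.add_apply, ContinuousMap.add_apply, Complex.add_re, h₁, h₂, mul_add,
          Complex.add_re]⟩
    · intro a τ _ h c
      obtain ⟨p, hp, h⟩ := h (c * a)
      exact ⟨p, hp, fun t => by rw [h, ContinuousMap.smul_apply, smul_eq_mul, mul_assoc]⟩
  obtain ⟨p, hp, h⟩ := key 1
  set c : ℝ := (∫ t, p t ∂μ𝕋).im
  refine ⟨p - (c * Complex.I) • fourier 0, Submodule.sub_mem _ hp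
    (Submodule.smul_mem _ _ (fourier_mem_analyticPoly le_rfl)), ?_, fun t => ?_⟩
  · simp only [ContinuousMap.sub_apply, ContinuousMap.smul_apply, fourier_zero]
    rw [integral_sub (integrable_of_continuousMap p) (integrable_const _)]
    simp [c]
  · simp [h]

theorem memLp_two_of_continuous {E : Type*} [NormedAddCommGroup E] {f : 𝕋 → E}
    (hf : Continuous f) : MemLp f 2 μ𝕋 :=
  hf.memLp_of_hasCompactSupport (HasCompactSupport.of_compactSpace _)

theorem eLpNorm_two_le_of_mem_analyticPoly {p : C(𝕋, ℂ)} (hp : p ∈ analyticPoly)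
    (him : (∫ t, p t ∂μ𝕋).im = 0) :
    eLpNorm p 2 μ𝕋 ≤ 2 * eLpNorm (fun t => (p t).re) 2 μ𝕋 := by
  have hc : Continuous p := map_continuous p
  have hre : Continuous fun t => (p t).re := Complex.continuous_re.comp hc
  have him' : Continuous fun t => (p t).im := Complex.continuous_im.comp hc
  have hcont_int : ∀ {f : 𝕋 → ℝ}, Continuous f → Integrable f μ𝕋 := fun hf =>
    hf.integrable_of_hasCompactSupport (HasCompactSupport.of_compactSpace _)
  have hre2 : Integrable (fun t => (p t).re * (p t).re) μ𝕋 := hcont_int (hre.mul hre)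
  have him2 : Integrable (fun t => (p t).im * (p t).im) μ𝕋 := hcont_int (him'.mul him')
  have hle : ∫ t, ‖p t‖ ^ 2 ∂μ𝕋 ≤ 2 * ∫ t, (p t).re ^ 2 ∂μ𝕋 := by
    have h := congrArg Complex.re (integral_mul_of_mem_analyticPoly hp hp)
    rw [Complex.mul_re, him, mul_zero, sub_zero] at h
    have h2 := integral_re (𝕜 := ℂ) (integrable_of_continuousMap (p * p))
    simp only [ContinuousMap.mul_apply] at h
    simp only [ContinuousMap.mul_apply, RCLike.re_to_complex, Complex.mul_re] at h2
    rw [h, integral_sub hre2 him2] at h2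
    have h3 : ∫ t, ‖p t‖ ^ 2 ∂μ𝕋
        = (∫ t, (p t).re * (p t).re ∂μ𝕋) + ∫ t, (p t).im * (p t).im ∂μ𝕋 := by
      rw [← integral_add hre2 him2]
      simp only [Complex.sq_norm, Complex.normSq_apply]
    rw [h3]
    simp only [sq]
    nlinarith [mul_self_nonneg (∫ t, p t ∂μ𝕋).re]
  rw [(memLp_two_of_continuous hc).eLpNorm_eq_integral_rpow_norm two_ne_zero ENNReal.ofNat_ne_top,
    (memLp_two_of_continuous hre).eLpNorm_eq_integral_rpow_norm two_ne_zero ENNReal.ofNat_ne_top,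
    show (2 : ℝ≥0∞) = ENNReal.ofReal 2 by simp, ← ENNReal.ofReal_mul zero_le_two]
  refine ENNReal.ofReal_le_ofReal ?_
  simp only [ENNReal.toReal_ofReal zero_le_two, Real.rpow_two, Real.norm_eq_abs, sq_abs]
  rw [← one_div, ← Real.sqrt_eq_rpow, ← Real.sqrt_eq_rpow]
  have h0 : 0 ≤ ∫ t, (p t).re ^ 2 ∂μ𝕋 := integral_nonneg fun t => sq_nonneg _
  refine Real.sqrt_le_iff.2 ⟨by positivity, ?_⟩
  rw [mul_pow, Real.sq_sqrt h0]
  linarith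

theorem exists_analyticPoly_approx {ψ : 𝕋 → ℝ} (hψ : MemLp ψ 2 μ𝕋) {ε : ℝ} (hε : 0 < ε)
    (hεψ : ∀ t, ε ≤ ψ t) {δ : ℝ} (hδ : 0 < δ) :
    ∃ p ∈ analyticPoly, (∫ t, p t ∂μ𝕋).im = 0 ∧ (∀ t, ε / 2 ≤ (p t).re) ∧
      eLpNorm (fun t => (p t).re - ψ t) 2 μ𝕋 ≤ ENNReal.ofReal δ := by
  obtain ⟨g, hg, -⟩ := hψ.exists_boundedContinuous_eLpNorm_sub_le ENNReal.ofNat_ne_top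
    (ε := ENNReal.ofReal (δ / 2)) (by simpa using hδ)
  let G : C(𝕋, ℂ) := ⟨fun t => ((max (g t) ε : ℝ) : ℂ),
    Complex.continuous_ofReal.comp (g.continuous.max continuous_const)⟩
  have hG : G ∈ closure (Submodule.span ℂ (Set.range (fourier (T := 2 * Real.pi))) :
      Set C(𝕋, ℂ)) := by
    rw [← Submodule.topologicalClosure_coe, span_fourier_closure_eq_top]
    trivial
  set η := min (ε / 2) (δ / 2) with hη
  obtain ⟨τ, hτ, hGτ⟩ := Metric.mem_closure_iff.1 hG η (by positivity)
  obtain ⟨p, hp, him, hre⟩ := exists_mem_analyticPoly_re_eq hτ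
  have hclose : ∀ t, |(p t).re - max (g t) ε| ≤ η := fun t => by
    have h1 := (ContinuousMap.dist_apply_le_dist (f := G) (g := τ) t).trans hGτ.le
    rw [dist_comm, dist_eq_norm] at h1
    rw [hre]
    simpa [G] using (Complex.abs_re_le_norm _).trans h1
  refine ⟨p, hp, him, fun t => ?_, ?_⟩
  · have h1 := (abs_le.1 (hclose t)).1
    have h2 := le_max_right (g t) ε
    have h3 := min_le_left (ε / 2) (δ / 2)
    linarith
  · have hc : Continuous fun t => (p t).re - max (g t) ε :=
      (Complex.continuous_re.comp (map_continuous p)).sub (g.continuous.max continuous_const)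
    have e1 : eLpNorm (fun t => (p t).re - max (g t) ε) 2 μ𝕋 ≤ ENNReal.ofReal (δ / 2) := by
      refine (eLpNorm_le_of_ae_bound (C := η)
        (Eventually.of_forall fun t => by simpa using hclose t)).trans ?_
      simp only [measure_univ, ENNReal.one_rpow, one_mul]
      exact ENNReal.ofReal_le_ofReal (min_le_right _ _)
    have e2 : eLpNorm (fun t => max (g t) ε - ψ t) 2 μ𝕋 ≤ ENNReal.ofReal (δ / 2) := by
      refine le_trans (eLpNorm_mono fun t => ?_) hg
      rw [Pi.sub_apply, Real.norm_eq_abs, Real.norm_eq_abs]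
      conv_lhs => rw [← max_eq_left (hεψ t)]
      rw [abs_sub_comm (ψ t)]
      exact abs_max_sub_max_le_abs _ _ _
    have hc' : Continuous fun t => max (g t) ε := g.continuous.max continuous_const
    have e3 := eLpNorm_add_le (p := 2) hc.aestronglyMeasurable
      ((hc'.aestronglyMeasurable (μ := μ𝕋)).sub hψ.1) one_le_two
    have e4 : ((fun t => (p t).re - max (g t) ε) + ((fun t => max (g t) ε) - ψ))
        = fun t => (p t).re - ψ t := by
      funext t
      simp
    rw [e4] at e3
    refine e3.trans ((add_le_add e1 e2).trans ?_)
    rw [← ENNReal.ofReal_add (by positivity) (by positivity), add_halves]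

theorem exists_isHerglotz {ψ : 𝕋 → ℝ} (hψ : MemLp ψ 2 μ𝕋) {ε : ℝ} (hε : 0 < ε)
    (hεψ : ∀ t, ε ≤ ψ t) :
    ∃ O, IsHerglotz O ∧ (∀ᵐ t ∂μ𝕋, (O t).re = ψ t) ∧
      eLpNorm O 2 μ𝕋 ≤ 2 * eLpNorm ψ 2 μ𝕋 := by
  set δ : ℕ → ℝ := fun n => (1 / 2) ^ n with hδ
  have hδ0 : ∀ n, 0 < δ n := fun n => by positivity
  have hδanti : Antitone δ := pow_right_anti₀ (by norm_num) (by norm_num)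
  choose p hp him hre hdist using fun n => exists_analyticPoly_approx hψ hε hεψ (hδ0 n)
  have hc : ∀ n, Continuous (p n) := fun n => map_continuous _
  have hcre : ∀ n, Continuous fun t => (p n t).re := fun n =>
    Complex.continuous_re.comp (hc n)
  have hδlim : Tendsto (fun n => ENNReal.ofReal (δ n)) atTop (𝓝 0) := by
    rw [← ENNReal.ofReal_zero]
    exact ENNReal.tendsto_ofReal (tendsto_pow_atTop_nhds_zero_of_lt_one (by norm_num)
      (by norm_num))
  have hcauchy : ∀ N n m, N ≤ n → N ≤ m →
      eLpNorm (p n - p m : 𝕋 → ℂ) 2 μ𝕋 < ENNReal.ofReal (5 * δ N) := by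
    intro N n m hn hm
    have h1 := eLpNorm_two_le_of_mem_analyticPoly (Submodule.sub_mem _ (hp n) (hp m)) (by
      simp only [ContinuousMap.sub_apply]
      rw [integral_sub (integrable_of_continuousMap _) (integrable_of_continuousMap _),
        Complex.sub_im, him, him, sub_zero])
    have h2 := eLpNorm_sub_le (p := 2) ((hcre n).aestronglyMeasurable.sub hψ.1)
      ((hcre m).aestronglyMeasurable.sub hψ.1) (μ := μ𝕋) one_le_two
    have h3 : ((fun t => (p n t).re) - ψ - ((fun t => (p m t).re) - ψ))
        = fun t => ((p n - p m) t).re := by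
      funext t
      simp
    rw [h3] at h2
    have h4 : eLpNorm (fun t => ((p n - p m) t).re) 2 μ𝕋 ≤ ENNReal.ofReal (2 * δ N) := by
      refine h2.trans ((add_le_add (hdist n) (hdist m)).trans ?_)
      rw [← ENNReal.ofReal_add (hδ0 n).le (hδ0 m).le]
      exact ENNReal.ofReal_le_ofReal (by linarith [hδanti hn, hδanti hm])
    refine (h1.trans (mul_le_mul_right h4 2)).trans_lt ?_
    rw [show (2 : ℝ≥0∞) = ENNReal.ofReal 2 by simp, ← ENNReal.ofReal_mul zero_le_two]
    exact (ENNReal.ofReal_lt_ofReal_iff (by linarith [hδ0 N])).2 (by linarith [hδ0 N])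
  obtain ⟨O, hO, hlim⟩ := Lp.cauchy_complete_eLpNorm one_le_two
    (fun n => memLp_two_of_continuous (hc n)) (B := fun N => ENNReal.ofReal (5 * δ N))
    (by
      rw [← ENNReal.ofReal_tsum_of_nonneg (fun n => by linarith [hδ0 n])
        ((summable_geometric_two).mul_left 5)]
      exact ENNReal.ofReal_ne_top) hcauchy
  obtain ⟨ns, hns, hae⟩ := (tendstoInMeasure_of_tendsto_eLpNorm two_ne_zero
    (fun n => (hc n).aestronglyMeasurable) hO.1 hlim).exists_seq_tendsto_ae
  have hlim' : Tendsto (fun n => eLpNorm ((fun t => (p (ns n) t).re) - ψ) 2 μ𝕋) atTop (𝓝 0) :=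
    tendsto_of_tendsto_of_tendsto_of_le_of_le tendsto_const_nhds
      (hδlim.comp hns.tendsto_atTop) (fun _ => bot_le) (fun n => hdist (ns n))
  obtain ⟨ms, hms, hae'⟩ := (tendstoInMeasure_of_tendsto_eLpNorm two_ne_zero
    (fun n => (hcre (ns n)).aestronglyMeasurable) hψ.1 hlim').exists_seq_tendsto_ae
  refine ⟨O, ⟨ε / 2, by positivity, fun n => p (ns n),
    fun n => isH1Multiplier_of_mem_analyticPoly (hp _),
    fun n => Eventually.of_forall (hre _), hae⟩, ?_, ?_⟩
  · filter_upwards [hae, hae'] with t h1 h2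
    exact tendsto_nhds_unique
      ((Complex.continuous_re.tendsto _).comp (h1.comp hms.tendsto_atTop)) h2
  · have hb : ∀ n, eLpNorm O 2 μ𝕋 ≤ eLpNorm (p n - O : 𝕋 → ℂ) 2 μ𝕋 +
        2 * (ENNReal.ofReal (δ n) + eLpNorm ψ 2 μ𝕋) := by
      intro n
      have h1 := eLpNorm_sub_le (p := 2) (hc n).aestronglyMeasurable
        ((hc n).aestronglyMeasurable.sub hO.1) (μ := μ𝕋) one_le_two
      have h0 : (p n - (p n - O) : 𝕋 → ℂ) = O := by
        funext t
        simp
      rw [h0] at h1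
      have h2 := eLpNorm_add_le (p := 2) ((hcre n).aestronglyMeasurable.sub hψ.1) hψ.1
        (μ := μ𝕋) one_le_two
      rw [sub_add_cancel] at h2
      refine h1.trans ?_
      rw [add_comm]
      gcongr
      refine (eLpNorm_two_le_of_mem_analyticPoly (hp n) (him n)).trans ?_
      gcongr
      exact h2.trans (add_le_add_left (hdist n) _)
    have hb' := hlim.add (ENNReal.Tendsto.const_mul (a := 2)
      (hδlim.add (tendsto_const_nhds (x := eLpNorm ψ 2 μ𝕋))) (Or.inr ENNReal.ofNat_ne_top))
    rw [zero_add, zero_add] at hb'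
    exact ge_of_tendsto' hb' hb

theorem eLpNorm_two_sq_eq_lintegral {E : Type*} [NormedAddCommGroup E] (f : 𝕋 → E) :
    eLpNorm f 2 μ𝕋 ^ 2 = ∫⁻ t, ‖f t‖ₑ ^ 2 ∂μ𝕋 := by
  simpa using eLpNorm_nnreal_pow_eq_lintegral (f := f) (μ := μ𝕋) (p := 2) two_ne_zero

theorem exists_isHerglotz_lintegral_le {ψ : 𝕋 → ℝ} (hψ : AEStronglyMeasurable ψ μ𝕋) {ε : ℝ}
    (hε : 0 < ε) (hεψ : ∀ t, ε ≤ ψ t) (hψ2 : ∫⁻ t, ‖ψ t‖ₑ ^ 2 ∂μ𝕋 < ⊤) :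
    ∃ O, IsHerglotz O ∧ (∀ᵐ t ∂μ𝕋, (O t).re = ψ t) ∧
      ∫⁻ t, ‖O t‖ₑ ^ 2 ∂μ𝕋 ≤ 4 * ∫⁻ t, ‖ψ t‖ₑ ^ 2 ∂μ𝕋 := by
  have hmem : MemLp ψ 2 μ𝕋 := by
    refine ⟨hψ, ?_⟩
    rw [← eLpNorm_two_sq_eq_lintegral] at hψ2
    exact lt_top_iff_ne_top.2 fun h => by simp [h] at hψ2
  obtain ⟨O, hO, hre, hle⟩ := exists_isHerglotz hmem hε hεψ
  refine ⟨O, hO, hre, ?_⟩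
  rw [← eLpNorm_two_sq_eq_lintegral, ← eLpNorm_two_sq_eq_lintegral]
  calc eLpNorm O 2 μ𝕋 ^ 2 ≤ (2 * eLpNorm ψ 2 μ𝕋) ^ 2 := by gcongr
    _ = 4 * eLpNorm ψ 2 μ𝕋 ^ 2 := by rw [mul_pow]; norm_num

section Pointwise

variable {A F U w : ℝ}

theorem max_sub_zero_le (hF : 0 ≤ F) (hw : 0 < w) (h : A ≤ F + U) :
    max (A - w) 0 ≤ 2 * F + 4 * (U ^ 2 / w) := by
  have h0 : 0 ≤ U ^ 2 / w := by positivity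
  refine max_le ?_ (by positivity)
  have h1 : U ≤ U ^ 2 / w + w := by
    have : U * w ≤ U ^ 2 + w ^ 2 := by nlinarith [sq_nonneg (U - w), sq_nonneg (U + w)]
    rw [div_add' _ _ _ hw.ne', le_div_iff₀ hw]
    linarith
  linarith

theorem mul_le_of_le_three {o x y : ℝ} (ho : 0 < o) (hA : 0 ≤ A) (hF : 0 ≤ F)
    (h : A ≤ F + U) (hx : x ≤ 3) (hxy : x ≤ 3 * (y / o)) :
    A * x ≤ 3 * (2 * F + 4 * (U ^ 2 / o ^ 2)) + 2 * y ^ 2 := by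
  have h0 : 0 ≤ U ^ 2 / o ^ 2 := by positivity
  rcases le_total A (2 * F) with h1 | h1
  · nlinarith [sq_nonneg y]
  · have h2 : A ≤ 2 * U := by linarith
    have h3 : A * x ≤ 3 * ((A / o) * y) := by
      calc A * x ≤ A * (3 * (y / o)) := by gcongr
        _ = 3 * ((A / o) * y) := by ring
    have h4 : (A / o) ^ 2 ≤ 4 * (U ^ 2 / o ^ 2) := by
      rw [div_pow, ← mul_div_assoc]
      gcongr
      nlinarith
    nlinarith [sq_nonneg (A / o - y), sq_nonneg y]

theorem sq_mul_sq_div_le {o x y : ℝ} (ho : 0 < o) (hA : 0 ≤ A) (hF : 0 ≤ F)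
    (h : A ≤ F + U) (hx0 : 0 ≤ x) (hx : x ≤ 5) (hy : 0 < y) (hxy : x ≤ 5 * (o / y))
    (hAy : A - o ^ 2 ≤ y ^ 2) :
    (A * x) ^ 2 / o ^ 2 ≤ 50 * (2 * F + 4 * (U ^ 2 / o ^ 2)) := by
  have h0 : 0 ≤ U ^ 2 / o ^ 2 := by positivity
  rcases le_total A (2 * F) with h1 | h1
  · suffices (A * x) ^ 2 / o ^ 2 ≤ 50 * A by linarith
    rcases le_total A (2 * o ^ 2) with h2 | h2
    · rw [div_le_iff₀ (by positivity)]
      have : x ^ 2 ≤ 5 ^ 2 := by gcongr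
      calc (A * x) ^ 2 = A * (A * x ^ 2) := by ring
        _ ≤ A * (2 * o ^ 2 * 5 ^ 2) := by gcongr
        _ = 50 * A * o ^ 2 := by ring
    · have h3 : x ^ 2 ≤ (5 * (o / y)) ^ 2 := by gcongr
      have h4 : A ≤ 2 * y ^ 2 := by linarith
      calc (A * x) ^ 2 / o ^ 2 = A * (A * x ^ 2) / o ^ 2 := by ring
        _ ≤ A * (2 * y ^ 2 * (5 * (o / y)) ^ 2) / o ^ 2 := by gcongr
        _ = 50 * A := by field_simp; ring
  · have h2 : A ≤ 2 * U := by linarith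
    have h3 : (A * x) ^ 2 ≤ 100 * U ^ 2 := by
      have : A * x ≤ 2 * U * 5 := by gcongr; linarith
      nlinarith [mul_nonneg hA hx0]
    calc (A * x) ^ 2 / o ^ 2 ≤ 100 * U ^ 2 / o ^ 2 := by gcongr
      _ = 100 * (U ^ 2 / o ^ 2) := by ring
      _ ≤ _ := by linarith

end Pointwise

theorem enorm_sq_div_enorm_sq {x y : ℂ} (hy : y ≠ 0) :
    ‖x‖ₑ ^ 2 / ‖y‖ₑ ^ 2 = ENNReal.ofReal (‖x‖ ^ 2 / ‖y‖ ^ 2) := by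
  have : 0 < ‖y‖ := norm_pos_iff.2 hy
  rw [ENNReal.ofReal_div_of_pos (by positivity), ENNReal.ofReal_pow (norm_nonneg _),
    ENNReal.ofReal_pow (norm_nonneg _), ofReal_norm, ofReal_norm]

/-- Analytic truncation: the couple formed by `H¹` and the space `H²` with weight `‖O‖⁻²` is
`K`-closed, at a normalized level. -/
theorem IsHerglotz.exists_decomposition_of_le {O A F U : 𝕋 → ℂ} (hO : IsHerglotz O)
    (hA : MemH1 A) (hF : AEStronglyMeasurable F μ𝕋) (hU : AEStronglyMeasurable U μ𝕋)
    (hAFU : ∀ t, A t = F t + U t) {a : ℝ} (ha : 0 < a)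
    (hFa : ∫⁻ t, ‖F t‖ₑ ∂μ𝕋 ≤ ENNReal.ofReal a)
    (hUa : ∫⁻ t, ‖U t‖ₑ ^ 2 / ‖O t‖ₑ ^ 2 ∂μ𝕋 ≤ ENNReal.ofReal a) :
    ∃ B D, MemH1 B ∧ MemH1 D ∧ (∀ t, A t = B t + D t) ∧
      ∫⁻ t, ‖B t‖ₑ ∂μ𝕋 ≤ 300 * ENNReal.ofReal a ∧
      ∫⁻ t, ‖D t‖ₑ ^ 2 / ‖O t‖ₑ ^ 2 ∂μ𝕋 ≤ 300 * ENNReal.ofReal a := by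
  have hOm := hO.aestronglyMeasurable
  have hne : ∀ᵐ t ∂μ𝕋, O t ≠ 0 := by
    filter_upwards [hO.re_pos] with t ht h
    simp [h] at ht
  set M : 𝕋 → ℝ := fun t => 2 * ‖F t‖ + 4 * (‖U t‖ ^ 2 / ‖O t‖ ^ 2) with hM
  have hM0 : ∀ t, 0 ≤ M t := fun t => by positivity
  have hMint : ∫⁻ t, ENNReal.ofReal (M t) ∂μ𝕋 ≤ 6 * ENNReal.ofReal a := by
    calc ∫⁻ t, ENNReal.ofReal (M t) ∂μ𝕋
        = ∫⁻ t, (2 * ‖F t‖ₑ + 4 * (‖U t‖ₑ ^ 2 / ‖O t‖ₑ ^ 2)) ∂μ𝕋 := by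
          refine lintegral_congr_ae ?_
          filter_upwards [hne] with t ht
          rw [enorm_sq_div_enorm_sq ht, hM, ENNReal.ofReal_add (by positivity) (by positivity),
            ENNReal.ofReal_mul zero_le_two, ENNReal.ofReal_mul zero_le_four, ofReal_norm]
          simp
      _ = 2 * ∫⁻ t, ‖F t‖ₑ ∂μ𝕋 + 4 * ∫⁻ t, ‖U t‖ₑ ^ 2 / ‖O t‖ₑ ^ 2 ∂μ𝕋 := by
          rw [lintegral_add_left' (hF.enorm.const_mul 2),
            lintegral_const_mul' _ _ ENNReal.ofNat_ne_top,
            lintegral_const_mul' _ _ ENNReal.ofNat_ne_top]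
      _ ≤ 2 * ENNReal.ofReal a + 4 * ENNReal.ofReal a := by gcongr
      _ = 6 * ENNReal.ofReal a := by rw [← add_mul]; norm_num
  have hAle : ∀ t, ‖A t‖ ≤ ‖F t‖ + ‖U t‖ := fun t => by
    rw [hAFU]
    exact norm_add_le _ _
  set ψ : 𝕋 → ℝ := fun t => √(max (‖A t‖ - ‖O t‖ ^ 2) 0) + √a with hψ
  have hψm : AEStronglyMeasurable ψ μ𝕋 := by
    have h1 : AEMeasurable (fun t => ‖A t‖) μ𝕋 := hA.1.1.norm.aemeasurable
    have h2 : AEMeasurable (fun t => ‖O t‖) μ𝕋 := hOm.norm.aemeasurable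
    exact ((((h1.sub (h2.pow_const 2)).max aemeasurable_const).sqrt).add_const
      _).aestronglyMeasurable
  have hMm : AEMeasurable M μ𝕋 :=
    (hF.norm.aemeasurable.const_mul 2).add
      (((hU.norm.aemeasurable.pow_const 2).div (hOm.norm.aemeasurable.pow_const 2)).const_mul 4)
  have hψint : ∫⁻ t, ‖ψ t‖ₑ ^ 2 ∂μ𝕋 ≤ 14 * ENNReal.ofReal a := by
    calc ∫⁻ t, ‖ψ t‖ₑ ^ 2 ∂μ𝕋 ≤ ∫⁻ t, (2 * ENNReal.ofReal (M t) + 2 * ENNReal.ofReal a) ∂μ𝕋 := by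
          refine lintegral_mono_ae ?_
          filter_upwards [hne] with t ht
          have h1 := max_sub_zero_le (norm_nonneg (F t))
            (by have := norm_pos_iff.2 ht; positivity : 0 < ‖O t‖ ^ 2) (hAle t)
          have h2 : ψ t ^ 2 ≤ 2 * M t + 2 * a := by
            have h3 := Real.sq_sqrt (le_max_right (‖A t‖ - ‖O t‖ ^ 2) 0)
            have h4 := Real.sq_sqrt ha.le
            simp only [hψ, hM]
            nlinarith [sq_nonneg (√(max (‖A t‖ - ‖O t‖ ^ 2) 0) - √a)]
          rw [← ofReal_norm, ← ENNReal.ofReal_pow (norm_nonneg _), Real.norm_eq_abs, sq_abs]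
          refine (ENNReal.ofReal_le_ofReal h2).trans ?_
          rw [ENNReal.ofReal_add (by linarith [hM0 t]) (by positivity),
            ENNReal.ofReal_mul zero_le_two, ENNReal.ofReal_mul zero_le_two]
          simp
      _ = 2 * ∫⁻ t, ENNReal.ofReal (M t) ∂μ𝕋 + 2 * ENNReal.ofReal a := by
          rw [lintegral_add_right _ measurable_const,
            lintegral_const_mul' _ _ ENNReal.ofNat_ne_top, lintegral_const, measure_univ, mul_one]
      _ ≤ 2 * (6 * ENNReal.ofReal a) + 2 * ENNReal.ofReal a := by gcongr
      _ = 14 * ENNReal.ofReal a := by rw [← mul_assoc, ← add_mul]; norm_num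
  obtain ⟨h, hh, hhre, hh_sq⟩ := exists_isHerglotz_lintegral_le hψm (Real.sqrt_pos.2 ha)
    (fun t => le_add_of_nonneg_left (Real.sqrt_nonneg _))
    (hψint.trans_lt (ENNReal.mul_lt_top ENNReal.ofNat_lt_top ENNReal.ofReal_lt_top))
  have hh_sq' : ∫⁻ t, ‖h t‖ₑ ^ 2 ∂μ𝕋 ≤ 56 * ENNReal.ofReal a := by
    refine hh_sq.trans ((mul_le_mul_right hψint 4).trans_eq ?_)
    rw [← mul_assoc]
    norm_num
  set q : 𝕋 → ℂ := fun t => sqrtQuotient (O t) (h t) with hq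
  have hqm : IsH1Multiplier q := hO.isH1Multiplier_sqrtQuotient hh
  have hφm : IsH1Multiplier (fun t => q t ^ 2 * (3 - 2 * q t)) :=
    (hqm.pow 2).mul ((IsH1Multiplier.const 3).sub (hqm.const_mul 2))
  set D : 𝕋 → ℂ := fun t => A t * (q t ^ 2 * (3 - 2 * q t)) with hD
  set B : 𝕋 → ℂ := fun t => A t * ((1 - q t) ^ 2 * (1 + 2 * q t)) with hB
  have hDH : MemH1 D := hφm.3 A hA
  have hBD : ∀ t, B t = A t - D t := fun t => by
    simp only [hB, hD]
    ring
  have hqbound : ∀ᵐ t ∂μ𝕋, ‖(1 - q t) ^ 2 * (1 + 2 * q t)‖ ≤ 3 ∧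
      ‖(1 - q t) ^ 2 * (1 + 2 * q t)‖ ≤ 3 * (‖h t‖ / ‖O t‖) ∧
      ‖q t ^ 2 * (3 - 2 * q t)‖ ≤ 5 ∧ ‖q t ^ 2 * (3 - 2 * q t)‖ ≤ 5 * (‖O t‖ / ‖h t‖) := by
    filter_upwards [hO.re_pos, hh.re_pos] with t h1 h2
    have o0 : 0 < ‖O t‖ := h1.trans_le (Complex.re_le_norm _)
    have h0 : 0 < ‖h t‖ := h2.trans_le (Complex.re_le_norm _)
    have q1 : ‖q t‖ ≤ 1 := norm_sqrtQuotient_le_one h1 h2.le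
    have q2 : ‖q t‖ ^ 2 ≤ ‖O t‖ / (‖O t‖ + ‖h t‖) := norm_sqrtQuotient_sq_le h1 h2.le
    have q3 : ‖1 - q t‖ ^ 2 ≤ ‖h t‖ / (‖O t‖ + ‖h t‖) := norm_one_sub_sqrtQuotient_sq_le h1 h2.le
    have e1 : ‖1 + 2 * q t‖ ≤ 3 := by
      refine (norm_add_le _ _).trans ?_
      rw [norm_mul, norm_one, Complex.norm_ofNat]
      linarith
    have e2 : ‖3 - 2 * q t‖ ≤ 5 := by
      refine (norm_sub_le _ _).trans ?_
      rw [norm_mul, Complex.norm_ofNat, Complex.norm_ofNat]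
      linarith
    have d1 : ‖h t‖ / (‖O t‖ + ‖h t‖) ≤ 1 := div_le_one_of_le₀ (by linarith) (by positivity)
    have d2 : ‖h t‖ / (‖O t‖ + ‖h t‖) ≤ ‖h t‖ / ‖O t‖ := by gcongr; linarith
    have d3 : ‖O t‖ / (‖O t‖ + ‖h t‖) ≤ 1 := div_le_one_of_le₀ (by linarith) (by positivity)
    have d4 : ‖O t‖ / (‖O t‖ + ‖h t‖) ≤ ‖O t‖ / ‖h t‖ := by gcongr; linarith
    rw [norm_mul, norm_mul, norm_pow, norm_pow]
    have f1 : ‖1 - q t‖ ^ 2 * ‖1 + 2 * q t‖ ≤ ‖1 - q t‖ ^ 2 * 3 := by gcongr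
    have f2 : ‖q t‖ ^ 2 * ‖3 - 2 * q t‖ ≤ ‖q t‖ ^ 2 * 5 := by gcongr
    refine ⟨?_, ?_, ?_, ?_⟩ <;> linarith
  refine ⟨B, D, ?_, hDH, fun t => by rw [hBD]; ring, ?_, ?_⟩
  · rw [funext hBD]
    exact hA.sub hDH
  · calc ∫⁻ t, ‖B t‖ₑ ∂μ𝕋
        ≤ ∫⁻ t, (3 * ENNReal.ofReal (M t) + 2 * ‖h t‖ₑ ^ 2) ∂μ𝕋 := by
          refine lintegral_mono_ae ?_
          filter_upwards [hqbound, hne] with t ht hot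
          have h1 := mul_le_of_le_three (norm_pos_iff.2 hot) (norm_nonneg (A t))
            (norm_nonneg (F t)) (hAle t) ht.1 ht.2.1
          rw [← norm_mul] at h1
          rw [← ofReal_norm]
          refine (ENNReal.ofReal_le_ofReal h1).trans ?_
          rw [ENNReal.ofReal_add (by positivity) (by positivity),
            ENNReal.ofReal_mul zero_le_three, ENNReal.ofReal_mul zero_le_two,
            ENNReal.ofReal_pow (norm_nonneg _), ofReal_norm]
          simp [hM]
      _ = 3 * ∫⁻ t, ENNReal.ofReal (M t) ∂μ𝕋 + 2 * ∫⁻ t, ‖h t‖ₑ ^ 2 ∂μ𝕋 := by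
          rw [lintegral_add_left' (hMm.ennreal_ofReal.const_mul 3),
            lintegral_const_mul' _ _ ENNReal.ofNat_ne_top,
            lintegral_const_mul' _ _ ENNReal.ofNat_ne_top]
      _ ≤ 3 * (6 * ENNReal.ofReal a) + 2 * (56 * ENNReal.ofReal a) := by gcongr
      _ = 130 * ENNReal.ofReal a := by rw [← mul_assoc, ← mul_assoc, ← add_mul]; norm_num
      _ ≤ 300 * ENNReal.ofReal a := by gcongr; norm_num
  · calc ∫⁻ t, ‖D t‖ₑ ^ 2 / ‖O t‖ₑ ^ 2 ∂μ𝕋 ≤ ∫⁻ t, 50 * ENNReal.ofReal (M t) ∂μ𝕋 := by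
          refine lintegral_mono_ae ?_
          filter_upwards [hqbound, hne, hhre, hh.re_pos] with t ht hot hre hpos
          have hψh : ψ t ≤ ‖h t‖ := hre ▸ Complex.re_le_norm _
          have hAy : ‖A t‖ - ‖O t‖ ^ 2 ≤ ‖h t‖ ^ 2 := by
            refine (le_max_left _ 0).trans ?_
            rw [← Real.sq_sqrt (le_max_right (‖A t‖ - ‖O t‖ ^ 2) 0)]
            gcongr
            exact (le_add_of_nonneg_right (Real.sqrt_nonneg a)).trans hψh
          have h1 := sq_mul_sq_div_le (norm_pos_iff.2 hot) (norm_nonneg (A t))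
            (norm_nonneg (F t)) (hAle t) (norm_nonneg _) ht.2.2.1
            (hpos.trans_le (Complex.re_le_norm _)) ht.2.2.2 hAy
          rw [← norm_mul] at h1
          rw [enorm_sq_div_enorm_sq hot]
          refine (ENNReal.ofReal_le_ofReal h1).trans ?_
          rw [ENNReal.ofReal_mul (by norm_num)]
          simp [hM]
      _ ≤ 50 * (6 * ENNReal.ofReal a) := by
          rw [lintegral_const_mul' _ _ ENNReal.ofNat_ne_top]
          gcongr
      _ = 300 * ENNReal.ofReal a := by rw [← mul_assoc]; norm_num

theorem IsHerglotz.exists_decomposition {O A F U : 𝕋 → ℂ} (hO : IsHerglotz O) (hA : MemH1 A)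
    (hF : AEStronglyMeasurable F μ𝕋) (hU : AEStronglyMeasurable U μ𝕋)
    (hAFU : ∀ t, A t = F t + U t) {x y : ℝ≥0∞} (hx0 : x ≠ 0) (hx : x ≠ ⊤) (hy0 : y ≠ 0)
    (hy : y ≠ ⊤) (hFx : ∫⁻ t, ‖F t‖ₑ ∂μ𝕋 ≤ x) (hUy : ∫⁻ t, ‖U t‖ₑ ^ 2 / ‖O t‖ₑ ^ 2 ∂μ𝕋 ≤ y) :
    ∃ B D : 𝕋 → ℂ, MemH1 B ∧ MemH1 D ∧ (∀ t, A t = B t + D t) ∧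
      ∫⁻ t, ‖B t‖ₑ ∂μ𝕋 ≤ 300 * x ∧ ∫⁻ t, ‖D t‖ₑ ^ 2 / ‖O t‖ₑ ^ 2 ∂μ𝕋 ≤ 300 * y := by
  obtain ⟨a, ha, rfl⟩ : ∃ a : ℝ, 0 < a ∧ ENNReal.ofReal a = x :=
    ⟨x.toReal, ENNReal.toReal_pos hx0 hx, ENNReal.ofReal_toReal hx⟩
  obtain ⟨b, hb, rfl⟩ : ∃ b : ℝ, 0 < b ∧ ENNReal.ofReal b = y :=
    ⟨y.toReal, ENNReal.toReal_pos hy0 hy, ENNReal.ofReal_toReal hy⟩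
  have hr : 0 < √(b / a) := Real.sqrt_pos.2 (div_pos hb ha)
  have hscale : ∀ V : 𝕋 → ℂ, ∫⁻ t, ‖V t‖ₑ ^ 2 / ‖(√(b / a) : ℂ) * O t‖ₑ ^ 2 ∂μ𝕋 =
      ENNReal.ofReal (a / b) * ∫⁻ t, ‖V t‖ₑ ^ 2 / ‖O t‖ₑ ^ 2 ∂μ𝕋 := by
    intro V
    rw [← lintegral_const_mul' _ _ ENNReal.ofReal_ne_top]
    refine lintegral_congr fun t => ?_
    have h1 : ‖(√(b / a) : ℂ)‖ₑ ^ 2 = ENNReal.ofReal (b / a) := by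
      rw [← ofReal_norm, ← ENNReal.ofReal_pow (norm_nonneg _), Complex.norm_real,
        Real.norm_eq_abs, sq_abs, Real.sq_sqrt (div_pos hb ha).le]
    rw [enorm_mul, mul_pow, h1, ENNReal.div_eq_inv_mul,
      ENNReal.mul_inv (Or.inl (by simp [div_pos hb ha])) (Or.inl ENNReal.ofReal_ne_top),
      ← ENNReal.ofReal_inv_of_pos (div_pos hb ha), inv_div, mul_assoc, ENNReal.div_eq_inv_mul]
  have hab : ENNReal.ofReal (a / b) * ENNReal.ofReal b = ENNReal.ofReal a := by
    rw [← ENNReal.ofReal_mul (by positivity), div_mul_cancel₀ _ hb.ne']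
  obtain ⟨B, D, hB, hD, hABD, hB', hD'⟩ := (hO.const_mul hr).exists_decomposition_of_le hA hF hU
    hAFU ha hFx (by
      rw [hscale, ← hab]
      gcongr)
  refine ⟨B, D, hB, hD, hABD, hB', ?_⟩
  rw [hscale, ← hab, mul_left_comm] at hD'
  exact (ENNReal.mul_le_mul_iff_right (by simp [div_pos ha hb]) ENNReal.ofReal_ne_top).1 hD'

theorem eLpLqNorm_one_one {f : ℕ → 𝕋 → ℂ} (hf : ∀ k, AEStronglyMeasurable (f k) μ𝕋) :
    eLpLqNorm 1 1 f = ∑' k, ∫⁻ t, ‖f k t‖ₑ ∂μ𝕋 := by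
  rw [← lintegral_tsum fun k => (hf k).enorm]
  simp [eLpLqNorm, enorm_eq_nnnorm]

theorem eLpLqNorm_one_two (f : ℕ → 𝕋 → ℂ) :
    eLpLqNorm 1 2 f = ∫⁻ t, (∑' k, ‖f k t‖ₑ ^ 2) ^ (1 / 2 : ℝ) ∂μ𝕋 := by
  simp [eLpLqNorm, enorm_eq_nnnorm]

theorem lintegral_enorm_le_eLpLqNorm {q : ℝ} (hq : 0 < q) (f : ℕ → 𝕋 → ℂ) (k : ℕ) :
    ∫⁻ t, ‖f k t‖ₑ ∂μ𝕋 ≤ eLpLqNorm 1 q f := by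
  simp only [eLpLqNorm, div_one, ENNReal.rpow_one]
  refine lintegral_mono fun t => ?_
  calc ‖f k t‖ₑ = ((‖f k t‖₊ : ℝ≥0∞) ^ q) ^ (1 / q) := by
        rw [← ENNReal.rpow_mul, mul_one_div_cancel hq.ne', ENNReal.rpow_one, enorm_eq_nnnorm]
    _ ≤ _ := by
        gcongr
        exact ENNReal.le_tsum (f := fun k => (‖f k t‖₊ : ℝ≥0∞) ^ q) k

theorem exists_eLpLqNorm_sub_lt {q : ℝ} {f : ℕ → 𝕋 → ℂ} {N : ℝ≥0∞} (h : quotNormLq q f < N) :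
    ∃ g : ℕ → 𝕋 → ℂ, (∀ k, MemH1 (g k)) ∧ eLpLqNorm 1 q (f - g) < N := by
  simpa only [quotNormLq, iInf_lt_iff, exists_prop] using h

theorem memH1_of_quotNormLq_eq_zero {q : ℝ} (hq : 0 < q) {f : ℕ → 𝕋 → ℂ}
    (hf : ∀ k, Integrable (f k) μ𝕋) (h : quotNormLq q f = 0) (k : ℕ) : MemH1 (f k) := by
  refine .of_forall_exists (hf k) fun ε hε => ?_
  obtain ⟨g, hg, hfg⟩ := exists_eLpLqNorm_sub_lt (h.trans_lt hε)
  exact ⟨g k, hg k, (lintegral_enorm_le_eLpLqNorm hq (f - g) k).trans hfg.le⟩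

/-- A function in `L¹` is dominated by the square of an outer function in `H²`. -/
theorem exists_isHerglotz_le_enorm_sq {u : 𝕋 → ℝ≥0∞} (hu : AEMeasurable u μ𝕋) {M : ℝ≥0∞}
    (hM0 : M ≠ 0) (hM : M ≠ ⊤) (huM : ∫⁻ t, u t ∂μ𝕋 ≤ M) :
    ∃ O, IsHerglotz O ∧ (∀ᵐ t ∂μ𝕋, u t ≤ ‖O t‖ₑ ^ 2) ∧ ∫⁻ t, ‖O t‖ₑ ^ 2 ∂μ𝕋 ≤ 16 * M := by
  have hψ2 : ∫⁻ t, ‖√(u t).toReal + √M.toReal‖ₑ ^ 2 ∂μ𝕋 ≤ 4 * M := by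
    calc _ ≤ ∫⁻ t, (2 * u t + 2 * M) ∂μ𝕋 := by
          refine lintegral_mono fun t => ?_
          have h1 : (√(u t).toReal + √M.toReal) ^ 2 ≤ 2 * (u t).toReal + 2 * M.toReal := by
            nlinarith [sq_nonneg (√(u t).toReal - √M.toReal),
              Real.sq_sqrt (ENNReal.toReal_nonneg (a := u t)),
              Real.sq_sqrt (ENNReal.toReal_nonneg (a := M))]
          rw [← ofReal_norm, ← ENNReal.ofReal_pow (norm_nonneg _), Real.norm_eq_abs, sq_abs]
          refine (ENNReal.ofReal_le_ofReal h1).trans ?_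
          rw [ENNReal.ofReal_add (by positivity) (by positivity), ENNReal.ofReal_mul zero_le_two,
            ENNReal.ofReal_mul zero_le_two, ENNReal.ofReal_ofNat]
          gcongr <;> exact ENNReal.ofReal_toReal_le
      _ = 2 * ∫⁻ t, u t ∂μ𝕋 + 2 * M := by
          rw [lintegral_add_right _ measurable_const,
            lintegral_const_mul' _ _ ENNReal.ofNat_ne_top, lintegral_const, measure_univ, mul_one]
      _ ≤ 2 * M + 2 * M := by gcongr
      _ = 4 * M := by ring
  obtain ⟨O, hO, hre, hO2⟩ := exists_isHerglotz_lintegral_le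
    (ψ := fun t => √(u t).toReal + √M.toReal) (ε := √M.toReal)
    (hu.ennreal_toReal.sqrt.add_const _).aestronglyMeasurable
    (Real.sqrt_pos.2 (ENNReal.toReal_pos hM0 hM)) (fun t => by simp)
    (hψ2.trans_lt (ENNReal.mul_lt_top ENNReal.ofNat_lt_top hM.lt_top))
  refine ⟨O, hO, ?_, hO2.trans ?_⟩
  · filter_upwards [hre, ae_lt_top' hu (huM.trans_lt hM.lt_top).ne] with t ht hut
    have h1 : √(u t).toReal ≤ ‖O t‖ :=
      calc √(u t).toReal ≤ (O t).re := by rw [ht]; simp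
        _ ≤ ‖O t‖ := Complex.re_le_norm _
    rw [← ENNReal.ofReal_toReal hut.ne, ← ofReal_norm, ← ENNReal.ofReal_pow (norm_nonneg _)]
    exact ENNReal.ofReal_le_ofReal (Real.sqrt_le_left (norm_nonneg _) |>.1 h1)
  · calc 4 * _ ≤ 4 * (4 * M) := by gcongr
      _ = 16 * M := by ring

theorem ENNReal.rpow_half_le_div_add {x w : ℝ≥0∞} (hw0 : w ≠ 0) (hw : w ≠ ⊤) :
    x ^ (1 / 2 : ℝ) ≤ x / w + w := by
  set s := x ^ (1 / 2 : ℝ) with hs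
  have hx : x = s * s := by
    rw [hs, ← ENNReal.rpow_add_of_nonneg _ _ (by norm_num) (by norm_num)]
    norm_num
  rcases le_total s w with h | h
  · exact h.trans le_add_self
  · refine le_add_right ?_
    rw [hx, ENNReal.le_div_iff_mul_le (Or.inl hw0) (Or.inl hw)]
    gcongr

theorem enorm_add_sq_le (x y : ℂ) : ‖x + y‖ₑ ^ 2 ≤ 2 * ‖x‖ₑ ^ 2 + 2 * ‖y‖ₑ ^ 2 := by
  have h : ‖x + y‖ ^ 2 ≤ 2 * ‖x‖ ^ 2 + 2 * ‖y‖ ^ 2 := by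
    have := norm_add_le x y
    nlinarith [sq_nonneg (‖x‖ - ‖y‖), norm_nonneg (x + y)]
  have h' := ENNReal.ofReal_le_ofReal h
  rwa [ENNReal.ofReal_add (by positivity) (by positivity), ENNReal.ofReal_mul zero_le_two,
    ENNReal.ofReal_mul zero_le_two, ENNReal.ofReal_ofNat, ENNReal.ofReal_pow (norm_nonneg _),
    ENNReal.ofReal_pow (norm_nonneg _), ENNReal.ofReal_pow (norm_nonneg _), ofReal_norm,
    ofReal_norm, ofReal_norm] at h'

/-- Two liftings, one controlled in `L¹(ℓ₁)` and one in `L¹(ℓ₂)`, can be merged into one. -/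
theorem exists_common_lifting {f h₁ h₂ : ℕ → 𝕋 → ℂ} (hf : ∀ k, AEStronglyMeasurable (f k) μ𝕋)
    (hh₁ : ∀ k, MemH1 (h₁ k)) (hh₂ : ∀ k, MemH1 (h₂ k)) {N M : ℝ≥0∞} (hN0 : N ≠ 0) (hN : N ≠ ⊤)
    (hM0 : M ≠ 0) (hM : M ≠ ⊤) (hfN : eLpLqNorm 1 1 (f - h₁) ≤ N)
    (hfM : eLpLqNorm 1 2 (f - h₂) ≤ M) :
    ∃ g : ℕ → 𝕋 → ℂ, (∀ k, MemH1 (g k)) ∧ eLpLqNorm 1 1 (f - g) ≤ 601 * N ∧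
      eLpLqNorm 1 2 (f - g) ≤ 1218 * M := by
  have hF : ∀ k, AEStronglyMeasurable ((f - h₁) k) μ𝕋 := fun k => (hf k).sub (hh₁ k).1.1
  have hU : ∀ k, AEStronglyMeasurable ((f - h₂) k) μ𝕋 := fun k => (hf k).sub (hh₂ k).1.1
  rw [eLpLqNorm_one_one hF] at hfN
  rw [eLpLqNorm_one_two] at hfM
  obtain ⟨O, hO, huO, hOM⟩ := exists_isHerglotz_le_enorm_sq
    ((AEMeasurable.tsum fun k => (hU k).enorm.pow_const 2).pow_const (1 / 2 : ℝ)) hM0 hM hfM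
  have hOm : AEMeasurable (fun t => ‖O t‖ₑ ^ 2) μ𝕋 := hO.aestronglyMeasurable.enorm.pow_const 2
  have hO0 : ∀ᵐ t ∂μ𝕋, ‖O t‖ₑ ^ 2 ≠ 0 := by
    filter_upwards [hO.re_pos] with t ht h
    have : O t = 0 := by simpa using h
    simp [this] at ht
  have hO_top : ∀ t, ‖O t‖ₑ ^ 2 ≠ ⊤ := fun t => by finiteness
  have hUO : ∀ k, AEMeasurable (fun t => ‖(f - h₂) k t‖ₑ ^ 2 / ‖O t‖ₑ ^ 2) μ𝕋 :=
    fun k => ((hU k).enorm.pow_const 2).div hOm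
  have hUM : ∑' k, ∫⁻ t, ‖(f - h₂) k t‖ₑ ^ 2 / ‖O t‖ₑ ^ 2 ∂μ𝕋 ≤ M := by
    rw [← lintegral_tsum hUO]
    refine (lintegral_mono_ae ?_).trans hfM
    filter_upwards [huO] with t ht
    simp only [div_eq_mul_inv]
    rw [ENNReal.tsum_mul_right, ← div_eq_mul_inv]
    refine ENNReal.div_le_of_le_mul ?_
    set v := ∑' k, ‖(f - h₂) k t‖ₑ ^ 2
    calc v = v ^ (1 / 2 : ℝ) * v ^ (1 / 2 : ℝ) := by
          rw [← ENNReal.rpow_add_of_nonneg _ _ (by norm_num) (by norm_num)]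
          norm_num
      _ ≤ v ^ (1 / 2 : ℝ) * ‖O t‖ₑ ^ 2 := by gcongr
  obtain ⟨ε, hε, hεN⟩ := ENNReal.exists_pos_sum_of_countable' hN0 ℕ
  obtain ⟨δ, hδ, hδM⟩ := ENNReal.exists_pos_sum_of_countable' hM0 ℕ
  have hdec : ∀ k, ∃ B D : 𝕋 → ℂ, MemH1 B ∧ MemH1 D ∧
      (∀ t, h₂ k t - h₁ k t = B t + D t) ∧
      ∫⁻ t, ‖B t‖ₑ ∂μ𝕋 ≤ 300 * (∫⁻ t, ‖(f - h₁) k t‖ₑ ∂μ𝕋 + ε k) ∧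
      ∫⁻ t, ‖D t‖ₑ ^ 2 / ‖O t‖ₑ ^ 2 ∂μ𝕋 ≤
        300 * (∫⁻ t, ‖(f - h₂) k t‖ₑ ^ 2 / ‖O t‖ₑ ^ 2 ∂μ𝕋 + δ k) := by
    intro k
    refine hO.exists_decomposition ((hh₂ k).sub (hh₁ k)) (hF k) (hU k).neg
      (fun t => by simp only [Pi.sub_apply, Pi.neg_apply]; ring) ?_ ?_ ?_ ?_ le_self_add ?_
    · simp [(hε k).ne']
    · exact ENNReal.add_ne_top.2 ⟨((ENNReal.le_tsum k).trans_lt (hfN.trans_lt hN.lt_top)).ne,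
        ((ENNReal.le_tsum k).trans_lt (hεN.trans hN.lt_top)).ne⟩
    · simp [(hδ k).ne']
    · exact ENNReal.add_ne_top.2 ⟨((ENNReal.le_tsum k).trans_lt (hUM.trans_lt hM.lt_top)).ne,
        ((ENNReal.le_tsum k).trans_lt (hδM.trans hM.lt_top)).ne⟩
    · simp only [Pi.neg_apply, enorm_neg]
      exact le_self_add
  choose B D hB hD hBD hBN hDM using hdec
  have hBN' : ∑' k, ∫⁻ t, ‖B k t‖ₑ ∂μ𝕋 ≤ 600 * N :=
    calc _ ≤ ∑' k, 300 * (∫⁻ t, ‖(f - h₁) k t‖ₑ ∂μ𝕋 + ε k) := ENNReal.tsum_le_tsum hBN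
      _ ≤ 300 * (N + N) := by
        rw [ENNReal.tsum_mul_left, ENNReal.tsum_add]
        gcongr
      _ = 600 * N := by ring
  have hDM' : ∑' k, ∫⁻ t, ‖D k t‖ₑ ^ 2 / ‖O t‖ₑ ^ 2 ∂μ𝕋 ≤ 600 * M :=
    calc _ ≤ ∑' k, 300 * (∫⁻ t, ‖(f - h₂) k t‖ₑ ^ 2 / ‖O t‖ₑ ^ 2 ∂μ𝕋 + δ k) :=
          ENNReal.tsum_le_tsum hDM
      _ ≤ 300 * (M + M) := by
        rw [ENNReal.tsum_mul_left, ENNReal.tsum_add]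
        gcongr
      _ = 600 * M := by ring
  have hg : ∀ k, MemH1 (fun t => h₁ k t + B k t) := fun k => (hh₁ k).add (hB k)
  refine ⟨fun k t => h₁ k t + B k t, hg, ?_, ?_⟩
  · rw [eLpLqNorm_one_one (f := f - fun k t => h₁ k t + B k t) fun k => (hf k).sub (hg k).1.1]
    calc _ ≤ ∑' k, (∫⁻ t, ‖(f - h₁) k t‖ₑ ∂μ𝕋 + ∫⁻ t, ‖B k t‖ₑ ∂μ𝕋) := by
          refine ENNReal.tsum_le_tsum fun k => ?_
          rw [← lintegral_add_left' (hF k).enorm]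
          refine lintegral_mono fun t => ?_
          simp only [Pi.sub_apply, ← sub_sub]
          exact enorm_sub_le
      _ ≤ N + 600 * N := by
          rw [ENNReal.tsum_add]
          gcongr
      _ = 601 * N := by ring
  · rw [eLpLqNorm_one_two]
    calc _ ≤ ∫⁻ t, ((∑' k, (2 * (‖(f - h₂) k t‖ₑ ^ 2 / ‖O t‖ₑ ^ 2) +
          2 * (‖D k t‖ₑ ^ 2 / ‖O t‖ₑ ^ 2))) + ‖O t‖ₑ ^ 2) ∂μ𝕋 := by
          refine lintegral_mono_ae ?_
          filter_upwards [hO0] with t ht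
          refine (ENNReal.rpow_half_le_div_add ht (hO_top t)).trans ?_
          gcongr
          rw [div_eq_mul_inv, ← ENNReal.tsum_mul_right]
          refine ENNReal.tsum_le_tsum fun k => ?_
          rw [← mul_div_assoc, ← mul_div_assoc, ← ENNReal.add_div, div_eq_mul_inv]
          gcongr
          have h : f k t - (h₁ k t + B k t) = (f - h₂) k t + D k t := by
            simp only [Pi.sub_apply]
            linear_combination hBD k t
          simp only [Pi.sub_apply] at h ⊢
          rw [h]
          exact enorm_add_sq_le _ _
      _ = 2 * ∑' k, ∫⁻ t, ‖(f - h₂) k t‖ₑ ^ 2 / ‖O t‖ₑ ^ 2 ∂μ𝕋 +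
          2 * ∑' k, ∫⁻ t, ‖D k t‖ₑ ^ 2 / ‖O t‖ₑ ^ 2 ∂μ𝕋 + ∫⁻ t, ‖O t‖ₑ ^ 2 ∂μ𝕋 := by
          have hDO : ∀ k, AEMeasurable (fun t => ‖D k t‖ₑ ^ 2 / ‖O t‖ₑ ^ 2) μ𝕋 :=
            fun k => ((hD k).1.1.enorm.pow_const 2).div hOm
          rw [lintegral_add_right' _ hOm,
            lintegral_tsum fun k => by have := hUO k; have := hDO k; fun_prop,
            ← ENNReal.tsum_mul_left, ← ENNReal.tsum_mul_left, ← ENNReal.tsum_add]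
          congr 2
          funext k
          rw [lintegral_add_right' _ ((hDO k).const_mul 2),
            lintegral_const_mul' _ _ ENNReal.ofNat_ne_top,
            lintegral_const_mul' _ _ ENNReal.ofNat_ne_top]
      _ ≤ 2 * M + 2 * (600 * M) + 16 * M := by gcongr
      _ = 1218 * M := by ring

/-- **Simultaneous good lifting**: there is an absolute constant `C` such that every
`f ∈ L¹(ℓ₁)` admits `g = (g_k)` with every `g_k ∈ H¹`,
`‖f − g‖_{L¹(ℓ₁)} ≤ C ‖f‖_{L¹/H¹(ℓ₁)}` and `‖f − g‖_{L¹(ℓ₂)} ≤ C ‖f‖_{L¹/H¹(ℓ₂)}`. -/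
theorem simultaneous_good_lifting :
    ∃ C : ℝ≥0, 0 < C ∧
      ∀ f : ℕ → 𝕋 → ℂ, MemLpLq 1 1 f →
        ∃ g : ℕ → 𝕋 → ℂ, (∀ k, MemH1 (g k)) ∧
          eLpLqNorm 1 1 (f - g) ≤ C * quotNormLq 1 f ∧
          eLpLqNorm 1 2 (f - g) ≤ C * quotNormLq 2 f := by
  refine ⟨2436, by norm_num, fun f hf => ?_⟩
  have hfint : ∀ k, Integrable (f k) μ𝕋 := fun k =>
    ⟨hf.1 k, (lintegral_enorm_le_eLpLqNorm one_pos f k).trans_lt hf.2⟩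
  by_cases h0 : quotNormLq 1 f = 0 ∨ quotNormLq 2 f = 0
  · refine ⟨f, fun k => h0.elim (memH1_of_quotNormLq_eq_zero one_pos hfint · k)
      (memH1_of_quotNormLq_eq_zero two_pos hfint · k), ?_, ?_⟩ <;> simp [eLpLqNorm]
  obtain ⟨hN0, hM0⟩ := not_or.1 h0
  have hN : quotNormLq 1 f ≠ ⊤ := by
    refine ((iInf₂_le (0 : ℕ → 𝕋 → ℂ) fun k => ⟨integrable_zero _ _ _, fun n _ => ?_⟩).trans_lt
      (?_ : eLpLqNorm 1 1 (f - 0) < ⊤)).ne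
    · simpa using hf.2
    · simp [fourierCoeff]
  have hlt : ∀ {x : ℝ≥0∞}, x ≠ 0 → x ≠ ⊤ → x < 2 * x := fun h0 h => by
    rw [two_mul]
    exact ENNReal.lt_add_right h h0
  obtain ⟨h₁, hh₁, hfh₁⟩ := exists_eLpLqNorm_sub_lt (hlt hN0 hN)
  by_cases hM : quotNormLq 2 f = ⊤
  · refine ⟨h₁, hh₁, hfh₁.le.trans ?_, ?_⟩
    · gcongr
      norm_num
    · rw [hM, ENNReal.mul_top (by norm_num)]
      exact le_top
  obtain ⟨h₂, hh₂, hfh₂⟩ := exists_eLpLqNorm_sub_lt (hlt hM0 hM)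
  obtain ⟨g, hg, hg₁, hg₂⟩ := exists_common_lifting hf.1 hh₁ hh₂
    (mul_ne_zero two_ne_zero hN0) (ENNReal.mul_ne_top ENNReal.ofNat_ne_top hN)
    (mul_ne_zero two_ne_zero hM0) (ENNReal.mul_ne_top ENNReal.ofNat_ne_top hM) hfh₁.le hfh₂.le
  refine ⟨g, hg, hg₁.trans ?_, hg₂.trans ?_⟩
  · rw [← mul_assoc]
    gcongr
    norm_num
  · rw [← mul_assoc]
    gcongr
    norm_num
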